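/- arXiv:1811.11227 — 2 statements merged into one kernel-verified Lean document; each statement's English description precedes it below -/
import Mathlib

section
/- Let L be an integral hermitian O_H-lattice with an orthogonal decomposition L = L_0 ⊕ M, where L_0 is π^0-modular and (x,y) ∈ πO_H for all x,y ∈ M. Then every Λ ∈ Vert(L) decomposes orthogonally as Λ = L_0 ⊕ Λ_1, where Λ_1 is a vertex lattice in the hermitian space M ⊗_{O_H} H satisfying M ⊆ Λ_1♯, and t(Λ_1) = t(Λ). -/
/- Common setup: ramified quadratic extension H/ℚ_p, ring of integers O_H,
   hermitian forms, lattices, duals, vertex lattices. -/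

open scoped Classical

noncomputable section

namespace Ramified

/-- The ring of integers of `H`: the integral closure of `ℤ_p` in `H`. -/
def OH (p : ℕ) [Fact (Nat.Prime p)] (H : Type) [Field H] [Algebra ℚ_[p] H] : Subring H :=
  letI : Algebra ℤ_[p] H := ((algebraMap ℚ_[p] H).comp PadicInt.Coe.ringHom).toAlgebra
  (integralClosure ℤ_[p] H).toSubring

/-- `H/ℚ_p` is a ramified quadratic extension with nontrivial Galois automorphism `conj`
and uniformizer `ϖ` satisfying `conj ϖ = -ϖ` and `ϖ² = π₀` a uniformizer of `ℤ_p`. -/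
structure IsRamifiedQuadratic (p : ℕ) [Fact (Nat.Prime p)] (H : Type) [Field H]
    [Algebra ℚ_[p] H] (conj : H ≃+* H) (ϖ : H) : Prop where
  conj_conj : ∀ x : H, conj (conj x) = x
  conj_fix : ∀ q : ℚ_[p], conj (algebraMap ℚ_[p] H q) = algebraMap ℚ_[p] H q
  conj_ne : conj ≠ RingEquiv.refl H
  dim_two : Module.finrank ℚ_[p] H = 2
  conj_unif : conj ϖ = -ϖ
  unif_sq : ∃ u : ℤ_[p]ˣ, ϖ * ϖ = algebraMap ℚ_[p] H ((u : ℤ_[p]) : ℚ_[p]) * (p : H)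

variable {p : ℕ} [Fact (Nat.Prime p)] {H : Type} [Field H] [Algebra ℚ_[p] H]

/-- Any `H`-module is an `O_H`-module by restriction of scalars. -/
instance moduleOH (C : Type) [AddCommGroup C] [Module H C] : Module (OH p H) C :=
  Module.compHom C (OH p H).subtype

variable {C : Type} [AddCommGroup C] [Module H C]

theorem oh_smul_def (c : OH p H) (x : C) : c • x = (c : H) • x := rfl

/-- A hermitian form on `C` with respect to the conjugation `conj` of `H`:
linear in the first variable, conjugate-symmetric. -/
structure HermForm (H : Type) [Field H] (C : Type) [AddCommGroup C] [Module H C]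
    (conj : H ≃+* H) where
  form : C → C → H
  form_add : ∀ x y z : C, form (x + y) z = form x z + form y z
  form_smul : ∀ (a : H) (x y : C), form (a • x) y = a * form x y
  form_conj : ∀ x y : C, form y x = conj (form x y)

variable {conj : H ≃+* H}

theorem HermForm.form_zero (φ : HermForm H C conj) (y : C) : φ.form 0 y = 0 := by
  have h := φ.form_smul (0 : H) 0 y
  simpa using h

/-- The dual lattice `Λ♯ = {x : C | φ(x, Λ) ⊆ O_H}`. -/
def HermForm.dual (φ : HermForm H C conj) (Λ : Submodule (OH p H) C) :
    Submodule (OH p H) C where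
  carrier := {x : C | ∀ y ∈ Λ, φ.form x y ∈ OH p H}
  add_mem' := by
    intro a b ha hb y hy
    rw [φ.form_add]
    exact add_mem (ha y hy) (hb y hy)
  zero_mem' := by
    intro y hy
    rw [HermForm.form_zero]
    exact zero_mem _
  smul_mem' := by
    intro c x hx y hy
    show φ.form ((c : H) • x) y ∈ OH p H
    rw [φ.form_smul]
    exact mul_mem c.2 (hx y hy)

/-- The orthogonal complement (in `C = L ⊗ H`) of a sublattice. -/
def HermForm.orthog (φ : HermForm H C conj) (N : Submodule (OH p H) C) :
    Submodule (OH p H) C where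
  carrier := {x : C | ∀ y ∈ N, φ.form x y = 0}
  add_mem' := by
    intro a b ha hb y hy
    rw [φ.form_add, ha y hy, hb y hy, add_zero]
  zero_mem' := by
    intro y hy
    rw [HermForm.form_zero]
  smul_mem' := by
    intro c x hx y hy
    show φ.form ((c : H) • x) y = 0
    rw [φ.form_smul, hx y hy, mul_zero]

/-- Scalar multiplication by `a : H`, as an `O_H`-linear map. -/
def smulMap (a : H) : C →ₗ[OH p H] C where
  toFun x := a • x
  map_add' x y := smul_add a x y
  map_smul' c x := by
    show a • ((c : H) • x) = (c : H) • (a • x)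
    rw [smul_comm]

/-- The lattice `a • Λ` for a scalar `a : H`. -/
def scale (a : H) (Λ : Submodule (OH p H) C) : Submodule (OH p H) C :=
  Λ.map (smulMap a)

/-- An `H`-subspace of `C`, viewed as an `O_H`-submodule. -/
def restrictOH (W : Submodule H C) : Submodule (OH p H) C where
  carrier := (W : Set C)
  add_mem' := fun ha hb => W.add_mem ha hb
  zero_mem' := W.zero_mem
  smul_mem' := fun c x hx => W.smul_mem (c : H) hx

/-- The cardinality of the quotient `Λ/N` (for `N ⊆ Λ` this is the usual quotient). -/
def quotCard (N Λ : Submodule (OH p H) C) : ℕ :=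
  Nat.card (Λ ⧸ N.comap Λ.subtype)

/-- A (full) `O_H`-lattice in `C`: finitely generated and spanning `C` over `H`. -/
def IsLattice (Λ : Submodule (OH p H) C) : Prop :=
  Λ.FG ∧ Submodule.span H (Λ : Set C) = ⊤

/-- A vertex lattice: a full lattice with `ϖΛ ⊆ Λ♯ ⊆ Λ`. -/
def IsVertexLattice (φ : HermForm H C conj) (ϖ : H) (Λ : Submodule (OH p H) C) : Prop :=
  IsLattice Λ ∧ scale ϖ Λ ≤ φ.dual Λ ∧ φ.dual Λ ≤ Λ

/-- `Λ ∈ Vert(L)`: a vertex lattice with `L ⊆ Λ♯`. -/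
def InVert (φ : HermForm H C conj) (ϖ : H) (L Λ : Submodule (OH p H) C) : Prop :=
  IsVertexLattice φ ϖ Λ ∧ L ≤ φ.dual Λ

/-- `M` is `a`-modular (e.g. `a = ϖ^i`): `(x, M) = a·O_H` for every maximal `x ∈ M`. -/
def IsPiModular (φ : HermForm H C conj) (ϖ a : H) (M : Submodule (OH p H) C) : Prop :=
  ∀ x ∈ M, x ∉ scale ϖ M →
    (fun y => φ.form x y) '' (M : Set C) = (fun c => a * c) '' ((OH p H : Set H))

/-- `N` is split: an orthogonal direct sum of hyperbolic planes `H(i)`. -/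
def IsSplitLat (φ : HermForm H C conj) (ϖ : H) (N : Submodule (OH p H) C) : Prop :=
  ∃ (s : ℕ) (e f : Fin s → C) (d : Fin s → ℕ),
    N = Submodule.span (OH p H) (Set.range e ∪ Set.range f) ∧
    (∀ j, φ.form (e j) (e j) = 0 ∧ φ.form (f j) (f j) = 0 ∧
      φ.form (e j) (f j) = ϖ ^ d j) ∧
    ∀ j j', j ≠ j' → φ.form (e j) (e j') = 0 ∧ φ.form (e j) (f j') = 0 ∧
      φ.form (f j) (e j') = 0 ∧ φ.form (f j) (f j') = 0

/-- The `O_H`-rank of a sublattice of `C` (the dimension of the subspace it spans). -/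
def rk (N : Submodule (OH p H) C) : ℕ :=
  Module.finrank H (Submodule.span H (N : Set C))

/-- A Jordan splitting `L = ⊕_{0 ≤ λ ≤ k} L_λ` with `L_λ` being `ϖ^λ`-modular (or zero). -/
structure JordanSplitting (φ : HermForm H C conj) (ϖ : H) (L : Submodule (OH p H) C)
    (k : ℕ) (Lc : ℕ → Submodule (OH p H) C) : Prop where
  sup_eq : L = ⨆ i ∈ Finset.range (k + 1), Lc i
  bot_of_gt : ∀ i, k < i → Lc i = ⊥
  disj : ∀ i ∈ Finset.range (k + 1),
    Disjoint (Lc i) (⨆ j ∈ (Finset.range (k + 1)).erase i, Lc j)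
  orthog : ∀ i j, i ≠ j → ∀ x ∈ Lc i, ∀ y ∈ Lc j, φ.form x y = 0
  modular : ∀ i ∈ Finset.range (k + 1), Lc i ≠ ⊥ → IsPiModular φ ϖ (ϖ ^ i) (Lc i)

/-- `L_{≥ t} = ⊕_{λ ≥ t} L_λ`. -/
def Lge (Lc : ℕ → Submodule (OH p H) C) (k t : ℕ) : Submodule (OH p H) C :=
  ⨆ i ∈ Finset.Icc t k, Lc i

/-- `m(L) = rank_{O_H} L_{≥1}`. -/
def mOf (Lc : ℕ → Submodule (OH p H) C) (k : ℕ) : ℕ :=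
  ∑ i ∈ Finset.Icc 1 k, rk (Lc i)

/-- The invariant `t(L)` from Theorem A. -/
def tOf (φ : HermForm H C conj) (ϖ : H) (Lc : ℕ → Submodule (OH p H) C) (k : ℕ) : ℕ :=
  if Odd (mOf Lc k) then mOf Lc k - 1
  else if IsSplitLat φ ϖ (Lge Lc k 1) then mOf Lc k
  else mOf Lc k - 2

/-- `n_odd = Σ_{λ ≥ 3, λ odd} rank L_λ`. -/
def nOdd (Lc : ℕ → Submodule (OH p H) C) (k : ℕ) : ℕ :=
  ∑ i ∈ (Finset.Icc 3 k).filter (fun i => Odd i), rk (Lc i)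

/-- `n_even = Σ_{λ ≥ 2, λ even} rank L_λ`. -/
def nEven (Lc : ℕ → Submodule (OH p H) C) (k : ℕ) : ℕ :=
  ∑ i ∈ (Finset.Icc 2 k).filter (fun i => Even i), rk (Lc i)

end Ramified

namespace Ramified

section Integers

variable {p : ℕ} [Fact (Nat.Prime p)] {H : Type} [Field H] [Algebra ℚ_[p] H]

theorem mem_OH_iff (x : H) :
    x ∈ OH p H ↔ ((algebraMap ℚ_[p] H).comp PadicInt.Coe.ringHom).IsIntegralElem x :=
  Iff.rfl

theorem algebraMap_coe_mem_OH (z : ℤ_[p]) : algebraMap ℚ_[p] H (z : ℚ_[p]) ∈ OH p H :=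
  (mem_OH_iff _).2 (RingHom.isIntegralElem_map (f := (algebraMap ℚ_[p] H).comp PadicInt.Coe.ringHom))

theorem exists_padicInt_of_algebraMap_mem_OH {q : ℚ_[p]} (hq : algebraMap ℚ_[p] H q ∈ OH p H) :
    ∃ z : ℤ_[p], (z : ℚ_[p]) = q := by
  obtain ⟨f, hf, hfq⟩ := (mem_OH_iff _).1 hq
  have hint : IsIntegral ℤ_[p] q := by
    refine ⟨f, hf, (algebraMap ℚ_[p] H).injective ?_⟩
    rw [map_zero, ← hfq, Polynomial.hom_eval₂]
    rfl
  exact IsIntegrallyClosed.isIntegral_iff.1 hint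

theorem ringEquiv_mem_OH {conj : H ≃+* H}
    (hconj : ∀ q : ℚ_[p], conj (algebraMap ℚ_[p] H q) = algebraMap ℚ_[p] H q)
    {x : H} (hx : x ∈ OH p H) : conj x ∈ OH p H := by
  obtain ⟨f, hf, hfx⟩ := (mem_OH_iff _).1 hx
  refine (mem_OH_iff _).2 ⟨f, hf, ?_⟩
  have h := congrArg conj.toRingHom hfx
  have hcomp : conj.toRingHom.comp ((algebraMap ℚ_[p] H).comp PadicInt.Coe.ringHom)
      = (algebraMap ℚ_[p] H).comp PadicInt.Coe.ringHom := RingHom.ext fun z => hconj _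
  rw [Polynomial.hom_eval₂, map_zero, hcomp] at h
  exact h

theorem exists_smul_mem_OH [FiniteDimensional ℚ_[p] H] (h : H) :
    ∃ z : ℤ_[p], z ≠ 0 ∧ algebraMap ℚ_[p] H (z : ℚ_[p]) * h ∈ OH p H := by
  let : Algebra ℤ_[p] H := ((algebraMap ℚ_[p] H).comp PadicInt.Coe.ringHom).toAlgebra
  have : IsScalarTower ℤ_[p] ℚ_[p] H := IsScalarTower.of_algebraMap_eq fun _ => rfl
  have halg : IsAlgebraic ℤ_[p] h :=
    (IsFractionRing.isAlgebraic_iff ℤ_[p] ℚ_[p] H).2 (Algebra.IsAlgebraic.isAlgebraic h)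
  obtain ⟨z, hz, hint⟩ := halg.exists_integral_multiple
  refine ⟨z, hz, ?_⟩
  rw [Algebra.smul_def] at hint
  exact hint

namespace IsRamifiedQuadratic

variable {conj : H ≃+* H} {ϖ : H}

theorem unif_ne_zero (hram : IsRamifiedQuadratic p H conj ϖ) : ϖ ≠ 0 := by
  rintro rfl
  obtain ⟨u, hu⟩ := hram.unif_sq
  have hp0 : (p : ℚ_[p]) ≠ 0 := by exact_mod_cast (Fact.out : Nat.Prime p).ne_zero
  rw [mul_zero, eq_comm, ← map_natCast (algebraMap ℚ_[p] H) p, ← map_mul, map_eq_zero] at hu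
  refine (mul_ne_zero ?_ hp0) hu
  simp

theorem unif_mem_OH (hram : IsRamifiedQuadratic p H conj ϖ) : ϖ ∈ OH p H := by
  obtain ⟨u, hu⟩ := hram.unif_sq
  let : Algebra ℤ_[p] H := ((algebraMap ℚ_[p] H).comp PadicInt.Coe.ringHom).toAlgebra
  have hsq : IsIntegral ℤ_[p] (ϖ ^ 2) := by
    rw [pow_two, hu]
    exact (OH p H).mul_mem (algebraMap_coe_mem_OH _) (natCast_mem _ p)
  exact hsq.of_pow two_pos

theorem inv_unif_notMem_OH (hram : IsRamifiedQuadratic p H conj ϖ) : ϖ⁻¹ ∉ OH p H := by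
  intro h
  obtain ⟨u, hu⟩ := hram.unif_sq
  have hmem : algebraMap ℚ_[p] H (p : ℚ_[p])⁻¹ ∈ OH p H := by
    have h' := mul_mem (algebraMap_coe_mem_OH (H := H) (u : ℤ_[p])) (mul_mem h h)
    have hu0 : algebraMap ℚ_[p] H ((u : ℤ_[p]) : ℚ_[p]) ≠ 0 := by simp
    rw [← mul_inv, hu, mul_inv, mul_inv_cancel_left₀ hu0] at h'
    simpa using h'
  obtain ⟨z, hz⟩ := exists_padicInt_of_algebraMap_mem_OH hmem
  have hle := z.2
  rw [hz, norm_inv, Padic.norm_p, inv_inv] at hle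
  exact absurd hle (not_le.2 (by exact_mod_cast (Fact.out : Nat.Prime p).one_lt))

theorem exists_unif_pow_mul_mem_OH (hram : IsRamifiedQuadratic p H conj ϖ) (h : H) :
    ∃ k : ℕ, ϖ ^ k * h ∈ OH p H := by
  have : FiniteDimensional ℚ_[p] H :=
    FiniteDimensional.of_finrank_pos (by rw [hram.dim_two]; exact two_pos)
  obtain ⟨u, hu⟩ := hram.unif_sq
  obtain ⟨z, hz, hmem⟩ := exists_smul_mem_OH (p := p) h
  refine ⟨2 * z.valuation, ?_⟩
  set v := PadicInt.unitCoeff hz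
  have hzv : algebraMap ℚ_[p] H (z : ℚ_[p])
      = algebraMap ℚ_[p] H ((v : ℤ_[p]) : ℚ_[p]) * (p : H) ^ z.valuation := by
    conv_lhs => rw [PadicInt.unitCoeff_spec hz]
    simp [v]
  have hv : algebraMap ℚ_[p] H (((v⁻¹ : ℤ_[p]ˣ) : ℤ_[p]) : ℚ_[p])
      * algebraMap ℚ_[p] H ((v : ℤ_[p]) : ℚ_[p]) = 1 := by
    rw [← map_mul, ← PadicInt.coe_mul, Units.inv_mul, PadicInt.coe_one, map_one]
  have key : ϖ ^ (2 * z.valuation) * h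
      = algebraMap ℚ_[p] H ((u : ℤ_[p]) : ℚ_[p]) ^ z.valuation *
        (algebraMap ℚ_[p] H (((v⁻¹ : ℤ_[p]ˣ) : ℤ_[p]) : ℚ_[p]) *
          (algebraMap ℚ_[p] H (z : ℚ_[p]) * h)) := by
    rw [hzv, pow_mul, pow_two, hu, mul_pow]
    linear_combination (-(algebraMap ℚ_[p] H ((u : ℤ_[p]) : ℚ_[p]) ^ z.valuation
      * (p : H) ^ z.valuation * h)) * hv
  rw [key]
  exact mul_mem (pow_mem (algebraMap_coe_mem_OH _) _) (mul_mem (algebraMap_coe_mem_OH _) hmem)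

end IsRamifiedQuadratic

end Integers

section Lattices

variable {p : ℕ} [Fact (Nat.Prime p)] {H : Type} [Field H] [Algebra ℚ_[p] H]
variable {C : Type} [AddCommGroup C] [Module H C] {conj : H ≃+* H} {ϖ : H}

theorem smul_mem_of_mem_OH (N : Submodule (OH p H) C) {a : H} (ha : a ∈ OH p H) {x : C}
    (hx : x ∈ N) : a • x ∈ N :=
  N.smul_mem (⟨a, ha⟩ : OH p H) hx

/-- The form vanishes on the spans of two orthogonal subsets. -/
theorem HermForm.form_eq_zero_of_mem_span (φ : HermForm H C conj) {S T : Set C}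
    (hST : ∀ x ∈ S, ∀ y ∈ T, φ.form x y = 0) {x y : C}
    (hx : x ∈ Submodule.span H S) (hy : y ∈ Submodule.span H T) : φ.form x y = 0 := by
  have hleft : ∀ (S : Set C) (y : C), (∀ x ∈ S, φ.form x y = 0) →
      ∀ x ∈ Submodule.span H S, φ.form x y = 0 := by
    intro S y hS x hx
    induction hx using Submodule.span_induction with
    | mem x hx => exact hS x hx
    | zero => exact φ.form_zero y
    | add a b _ _ ha hb => rw [φ.form_add, ha, hb, add_zero]
    | smul a b _ hb => rw [φ.form_smul, hb, mul_zero]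
  have hswap : ∀ a b : C, φ.form a b = 0 → φ.form b a = 0 := fun a b h => by
    rw [φ.form_conj, h, map_zero]
  exact hswap _ _ (hleft T x (fun t ht => hswap _ _ (hleft S t (fun s hs => hST s hs t ht) x hx)) y hy)

theorem HermForm.dual_anti (φ : HermForm H C conj) {Λ Λ' : Submodule (OH p H) C} (h : Λ ≤ Λ') :
    φ.dual Λ' ≤ φ.dual Λ :=
  fun _ hx y hy => hx y (h hy)

theorem IsRamifiedQuadratic.exists_unif_pow_smul_mem (hram : IsRamifiedQuadratic p H conj ϖ)
    (N : Submodule (OH p H) C) {x : C} (hx : x ∈ Submodule.span H (N : Set C)) :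
    ∃ k : ℕ, ϖ ^ k • x ∈ N := by
  have hpow : ∀ k, ϖ ^ k ∈ OH p H := fun k => pow_mem hram.unif_mem_OH k
  induction hx using Submodule.span_induction with
  | mem x hx => exact ⟨0, by simpa using hx⟩
  | zero => exact ⟨0, by simp⟩
  | add a b _ _ ha hb =>
    obtain ⟨k, hk⟩ := ha
    obtain ⟨l, hl⟩ := hb
    refine ⟨k + l, ?_⟩
    rw [smul_add]
    refine N.add_mem ?_ ?_
    · rw [add_comm k l, pow_add, mul_smul]
      exact smul_mem_of_mem_OH N (hpow l) hk
    · rw [pow_add, mul_smul]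
      exact smul_mem_of_mem_OH N (hpow k) hl
  | smul a b _ hb =>
    obtain ⟨k, hk⟩ := hb
    obtain ⟨l, hl⟩ := hram.exists_unif_pow_mul_mem_OH a
    refine ⟨l + k, ?_⟩
    have : ϖ ^ (l + k) • a • b = (ϖ ^ l * a) • ϖ ^ k • b := by
      rw [smul_smul, smul_smul, pow_add]
      congr 1
      ring
    rw [this]
    exact smul_mem_of_mem_OH N hl hk

/-- A unimodular lattice contains every vector of its span which pairs integrally with it. -/
theorem IsPiModular.mem_of_mem_span_of_mem_dual {φ : HermForm H C conj}
    (hram : IsRamifiedQuadratic p H conj ϖ) {N : Submodule (OH p H) C}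
    (hN : IsPiModular φ ϖ (ϖ ^ 0) N) {x : C} (hx : x ∈ Submodule.span H (N : Set C))
    (hdual : x ∈ φ.dual N) : x ∈ N := by
  have hex := hram.exists_unif_pow_smul_mem N hx
  rcases hk : Nat.find hex with _ | j
  · have := Nat.find_spec hex
    rw [hk] at this
    simpa using this
  exfalso
  have hmem : ϖ ^ (j + 1) • x ∈ N := hk ▸ Nat.find_spec hex
  have hprim : ϖ ^ (j + 1) • x ∉ scale ϖ N := by
    rintro ⟨z, hz, hzx⟩
    have hz' : ϖ • z = ϖ • ϖ ^ j • x := by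
      rw [smul_smul, ← pow_succ']
      exact hzx
    have hzj : z = ϖ ^ j • x := smul_right_injective C hram.unif_ne_zero hz'
    exact Nat.find_min hex (m := j) (by omega) (hzj ▸ hz)
  have hone : (1 : H) ∈ (fun y => φ.form (ϖ ^ (j + 1) • x) y) '' (N : Set C) := by
    rw [hN _ hmem hprim]
    exact ⟨1, one_mem (OH p H), by simp⟩
  obtain ⟨y, hy, hxy⟩ := hone
  refine hram.inv_unif_notMem_OH ?_
  have hinv : ϖ⁻¹ = ϖ ^ j * φ.form x y := by
    refine inv_eq_of_mul_eq_one_right ?_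
    simp only [φ.form_smul] at hxy
    rw [← hxy]
    ring
  rw [hinv]
  exact mul_mem (pow_mem hram.unif_mem_OH j) (hdual y hy)

theorem fg_right_of_disjoint_of_fg_sup {R V : Type*} [Ring R] [AddCommGroup V] [Module R V]
    {A B : Submodule R V} (hd : Disjoint A B) (hfg : (A ⊔ B).FG) : B.FG := by
  obtain ⟨S, hS⟩ := hfg
  have hdec : ∀ s ∈ S, ∃ b ∈ B, s - b ∈ A := by
    intro s hs
    have : s ∈ A ⊔ B := hS ▸ Submodule.subset_span hs
    obtain ⟨a, ha, b, hb, rfl⟩ := Submodule.mem_sup.1 this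
    exact ⟨b, hb, by simpa using ha⟩
  choose! g hg hgA using hdec
  refine ⟨S.image g, ?_⟩
  have hle : Submodule.span R ((S.image g : Finset V) : Set V) ≤ B := by
    rw [Submodule.span_le, Finset.coe_image]
    rintro _ ⟨s, hs, rfl⟩
    exact hg s hs
  refine eq_of_le_of_inf_le_of_sup_le (z := A) hle ?_ ?_
  · rw [inf_comm, hd.eq_bot]
    exact bot_le
  · rw [sup_comm, ← hS, Submodule.span_le]
    intro s hs
    have h1 : g s ∈ Submodule.span R ((S.image g : Finset V) : Set V) :=
      Submodule.subset_span (Finset.mem_coe.2 (Finset.mem_image_of_mem g hs))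
    have := Submodule.add_mem_sup h1 (hgA s hs)
    simpa using this

theorem quotCard_inf_eq_quotCard_sup (A B : Submodule (OH p H) C) :
    quotCard (A ⊓ B) A = quotCard B (A ⊔ B) := by
  refine Nat.card_congr ?_
  refine (Submodule.quotEquivOfEq _ _ ?_).toEquiv.trans
    (LinearMap.quotientInfEquivSupQuotient A B).toEquiv
  ext x
  simp

end Lattices

/-- If `L = L₀ ⊕ M` orthogonally, with `L₀` being `ϖ^0`-modular and the
form taking values in `ϖ·O_H` on `M`, then every `Λ ∈ Vert(L)` decomposes orthogonally as
`Λ = L₀ ⊕ Λ₁` with `Λ₁` a vertex lattice in the hermitian space `M ⊗ H` satisfying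
`M ⊆ Λ₁♯` and `t(Λ₁) = t(Λ)`. -/
theorem statement_1 (p : ℕ) [Fact (Nat.Prime p)] (hp : p ≠ 2)
    (H : Type) [Field H] [Algebra ℚ_[p] H] (conj : H ≃+* H) (ϖ : H)
    (hram : IsRamifiedQuadratic p H conj ϖ)
    (C : Type) [AddCommGroup C] [Module H C]
    (φ : HermForm H C conj)
    (hnd : ∀ x : C, (∀ y : C, φ.form x y = 0) → x = 0)
    (L0 M : Submodule (OH p H) C)
    (hL : IsLattice (L0 ⊔ M))
    (hLint : L0 ⊔ M ≤ φ.dual (L0 ⊔ M))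
    (hdisj : Disjoint L0 M)
    (horth : ∀ x ∈ L0, ∀ y ∈ M, φ.form x y = 0)
    (hmod0 : IsPiModular φ ϖ (ϖ ^ 0) L0)
    (hMπ : ∀ x ∈ M, ∀ y ∈ M, ∃ a ∈ OH p H, φ.form x y = ϖ * a)
    (Λ : Submodule (OH p H) C)
    (hΛ : InVert φ ϖ (L0 ⊔ M) Λ) :
    ∃ Λ1 : Submodule (OH p H) C,
      -- `Λ₁` lives in the hermitian space `M ⊗_{O_H} H`
      (Λ1 : Set C) ⊆ (Submodule.span H (M : Set C) : Set C) ∧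
      -- orthogonal decomposition `Λ = L₀ ⊕ Λ₁`
      Λ = L0 ⊔ Λ1 ∧ Disjoint L0 Λ1 ∧
      (∀ x ∈ L0, ∀ y ∈ Λ1, φ.form x y = 0) ∧
      -- `Λ₁` is a vertex lattice in `M ⊗_{O_H} H` (dual taken inside that subspace)
      Λ1.FG ∧ Submodule.span H (Λ1 : Set C) = Submodule.span H (M : Set C) ∧
      scale ϖ Λ1 ≤ φ.dual Λ1 ⊓ restrictOH (Submodule.span H (M : Set C)) ∧
      φ.dual Λ1 ⊓ restrictOH (Submodule.span H (M : Set C)) ≤ Λ1 ∧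
      -- `M ⊆ Λ₁♯`
      M ≤ φ.dual Λ1 ∧
      -- `t(Λ₁) = t(Λ)`
      quotCard (φ.dual Λ1 ⊓ restrictOH (Submodule.span H (M : Set C))) Λ1
        = quotCard (φ.dual Λ) Λ := by
  obtain ⟨⟨⟨hΛfg, -⟩, hπΛ, hΛd⟩, hLΛ⟩ := hΛ
  set W := Submodule.span H (M : Set C) with hW
  have hL0Λ : L0 ≤ φ.dual Λ := le_sup_left.trans hLΛ
  have hMΛ : M ≤ φ.dual Λ := le_sup_right.trans hLΛ
  have hperp : ∀ x ∈ Submodule.span H (L0 : Set C), ∀ y ∈ W, φ.form x y = 0 :=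
    fun x hx y hy => φ.form_eq_zero_of_mem_span horth hx hy
  have hperp' : ∀ y ∈ W, ∀ x ∈ Submodule.span H (L0 : Set C), φ.form y x = 0 :=
    fun y hy x hx => by rw [φ.form_conj, hperp x hx y hy, map_zero]
  have hspan : Submodule.span H (L0 : Set C) ⊔ W = ⊤ := by
    rw [eq_top_iff, ← hL.2, Submodule.span_le]
    intro x hx
    obtain ⟨a, ha, b, hb, rfl⟩ := Submodule.mem_sup.1 hx
    exact Submodule.add_mem_sup (Submodule.subset_span ha) (Submodule.subset_span hb)
  have hL0W : ∀ x ∈ L0, x ∈ W → x = 0 := by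
    intro x hx hxW
    refine hnd x fun y => ?_
    obtain ⟨a, ha, b, hb, rfl⟩ := Submodule.mem_sup.1 (hspan ▸ Submodule.mem_top : y ∈ _ ⊔ W)
    rw [φ.form_conj, φ.form_add, hperp a ha x hxW,
      hperp' b hb x (Submodule.subset_span hx), add_zero, map_zero]
  have hsup : Λ = L0 ⊔ (Λ ⊓ restrictOH W) := by
    refine le_antisymm (fun x hx => ?_) (sup_le (hL0Λ.trans hΛd) inf_le_left)
    obtain ⟨u, hu, v, hv, rfl⟩ := Submodule.mem_sup.1 (hspan ▸ Submodule.mem_top : x ∈ _ ⊔ W)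
    have huL0 : u ∈ L0 := by
      refine hmod0.mem_of_mem_span_of_mem_dual hram hu fun y hy => ?_
      have h := ringEquiv_mem_OH hram.conj_fix (hL0Λ hy _ hx)
      rwa [← φ.form_conj, φ.form_add, hperp' v hv y (Submodule.subset_span hy), add_zero] at h
    refine Submodule.add_mem_sup huL0 ⟨?_, hv⟩
    simpa using Λ.sub_mem hx (hΛd (hL0Λ huL0))
  have hdis : Disjoint L0 (Λ ⊓ restrictOH W) := by
    rw [Submodule.disjoint_def]
    exact fun x hx hx' => hL0W x hx hx'.2
  have hdual : φ.dual (Λ ⊓ restrictOH W) ⊓ restrictOH W ≤ φ.dual Λ := by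
    rintro x ⟨hx, hxW⟩ y hy
    rw [hsup] at hy
    obtain ⟨a, ha, b, hb, rfl⟩ := Submodule.mem_sup.1 hy
    rw [φ.form_conj, φ.form_add, hperp a (Submodule.subset_span ha) x hxW, zero_add,
      ← φ.form_conj]
    exact hx b hb
  refine ⟨Λ ⊓ restrictOH W, fun x hx => hx.2, hsup, hdis,
    fun x hx y hy => hperp x (Submodule.subset_span hx) y hy.2,
    fg_right_of_disjoint_of_fg_sup hdis (hsup ▸ hΛfg), ?_, ?_,
    fun x hx => ⟨hΛd (hdual hx), hx.2⟩, hMΛ.trans (φ.dual_anti inf_le_left), ?_⟩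
  · refine le_antisymm (Submodule.span_le.2 fun x hx => hx.2) (Submodule.span_mono ?_)
    exact fun x hx => ⟨hΛd (hMΛ hx), Submodule.subset_span hx⟩
  · rintro _ ⟨x, hx, rfl⟩
    exact ⟨φ.dual_anti inf_le_left (hπΛ ⟨x, hx.1, rfl⟩), W.smul_mem ϖ hx.2⟩
  · have h1 : φ.dual (Λ ⊓ restrictOH W) ⊓ restrictOH W = (Λ ⊓ restrictOH W) ⊓ φ.dual Λ :=
      le_antisymm (fun x hx => ⟨⟨hΛd (hdual hx), hx.2⟩, hdual hx⟩)
        (fun x hx => ⟨φ.dual_anti inf_le_left hx.2, hx.1.2⟩)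
    have h2 : (Λ ⊓ restrictOH W) ⊔ φ.dual Λ = Λ := by
      refine le_antisymm (sup_le inf_le_left hΛd) ?_
      conv_lhs => rw [hsup]
      exact sup_le (hL0Λ.trans le_sup_right) le_sup_left
    rw [h1, quotCard_inf_eq_quotCard_sup, h2]

end Ramified
end
end

section
/- Let L be a hermitian O_H-lattice of rank m with (x,y) ∈ πO_H for all x,y ∈ L. If Λ ∈ Vert(L) satisfies t(Λ) = m − 2 and dim_{𝔽_p}((π^{-1}Λ♯ ∩ L♯)/Λ) = 2, then π^{-1}Λ♯ ⊆ L♯. -/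
/- Common setup: ramified quadratic extension H/ℚ_p, ring of integers O_H,
   hermitian forms, lattices, duals, vertex lattices. -/

open scoped Classical

noncomputable section

namespace Ramified

/-- A free `ℤ_p`-module of rank `k` has `p`-reduction of cardinality `p ^ k`. -/
theorem index_range_nsmul_of_basis {p : ℕ} [Fact (Nat.Prime p)] {M : Type} [AddCommGroup M]
    [Module ℤ_[p] M] {k : ℕ} (b : Module.Basis (Fin k) ℤ_[p] M) :
    (nsmulAddMonoidHom p : M →+ M).range.index = p ^ k := by
  let f : M →+ (Fin k → ZMod p) :=
    { toFun := fun x i => PadicInt.toZMod (b.equivFun x i)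
      map_zero' := by ext i; simp
      map_add' := fun x y => by ext i; simp }
  have hker : (nsmulAddMonoidHom p : M →+ M).range = f.ker := by
    ext x
    rw [AddMonoidHom.mem_range, AddMonoidHom.mem_ker]
    constructor
    · rintro ⟨y, rfl⟩
      ext i
      simp [f]
    · intro hx
      have hdvd : ∀ i, ∃ c : ℤ_[p], b.equivFun x i = p * c := by
        intro i
        have hi : PadicInt.toZMod (b.equivFun x i) = 0 := congrFun hx i
        rw [← RingHom.mem_ker, PadicInt.ker_toZMod, PadicInt.maximalIdeal_eq_span_p,
          Ideal.mem_span_singleton] at hi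
        exact hi
      choose c hc using hdvd
      refine ⟨b.equivFun.symm c, b.equivFun.injective ?_⟩
      ext i
      simp only [nsmulAddMonoidHom_apply, map_nsmul, LinearEquiv.apply_symm_apply, hc,
        Pi.smul_apply, nsmul_eq_mul]
  have hsurj : Function.Surjective f := by
    intro v
    choose c hc using fun i => ZMod.ringHom_surjective (PadicInt.toZMod (p := p)) (v i)
    refine ⟨b.equivFun.symm c, ?_⟩
    ext i
    simp only [f, AddMonoidHom.coe_mk, ZeroHom.coe_mk, LinearEquiv.apply_symm_apply, hc]
  rw [hker, AddSubgroup.index_ker, AddMonoidHom.range_eq_top.mpr hsurj]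
  simp [Nat.card_eq_fintype_card]

/-- A finitely generated `ℤ_p`-submodule of a finite-dimensional `ℚ_p`-space `V` has
`p`-reduction of cardinality at most `p ^ dim V`. -/
theorem exists_index_range_nsmul {p : ℕ} [Fact (Nat.Prime p)] {V : Type} [AddCommGroup V]
    [Module ℚ_[p] V] [FiniteDimensional ℚ_[p] V] [Module ℤ_[p] V]
    [IsScalarTower ℤ_[p] ℚ_[p] V] (T : Submodule ℤ_[p] V) (hT : T.FG) :
    ∃ k ≤ Module.finrank ℚ_[p] V, (nsmulAddMonoidHom p : T →+ T).range.index = p ^ k := by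
  have : Module.Finite ℤ_[p] T := Module.Finite.iff_fg.mpr hT
  have : Module.IsTorsionFree ℤ_[p] V := Module.IsTorsionFree.trans_faithfulSMul ℤ_[p] ℚ_[p] V
  let b := Module.finBasis ℤ_[p] T
  refine ⟨_, ?_, index_range_nsmul_of_basis b⟩
  have hb : LinearIndependent ℤ_[p] (fun i => (b i : V)) :=
    b.linearIndependent.map' T.subtype (Submodule.ker_subtype T)
  rw [LinearIndependent.iff_fractionRing ℤ_[p] ℚ_[p]] at hb
  simpa using hb.fintype_card_le_finrank

section Lattice

variable (p : ℕ) [Fact (Nat.Prime p)] {H : Type} [Field H] [Algebra ℚ_[p] H]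
  {C : Type} [AddCommGroup C] [Module H C]

/-- The structure map `ℤ_p → O_H`. -/
def zpToOH : ℤ_[p] →+* OH p H :=
  ((algebraMap ℚ_[p] H).comp PadicInt.Coe.ringHom).codRestrict (OH p H) fun x => by
    let : Algebra ℤ_[p] H := ((algebraMap ℚ_[p] H).comp PadicInt.Coe.ringHom).toAlgebra
    exact (integralClosure ℤ_[p] H).algebraMap_mem x

variable {p}

theorem zpToOH_finite [FiniteDimensional ℚ_[p] H] : (zpToOH p (H := H)).Finite := by
  let : Algebra ℤ_[p] H := ((algebraMap ℚ_[p] H).comp PadicInt.Coe.ringHom).toAlgebra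
  let : Algebra ℤ_[p] (OH p H) := (zpToOH p (H := H)).toAlgebra
  have : IsScalarTower ℤ_[p] ℚ_[p] H := IsScalarTower.of_algebraMap_eq fun _ => rfl
  have : IsScalarTower ℤ_[p] (OH p H) H := IsScalarTower.of_algebraMap_eq fun _ => rfl
  have : IsIntegralClosure (OH p H) ℤ_[p] H :=
    { algebraMap_injective := Subtype.val_injective
      isIntegral_iff := fun {x} => ⟨fun hx => ⟨⟨x, hx⟩, rfl⟩, by rintro ⟨y, rfl⟩; exact y.2⟩ }
  exact IsIntegralClosure.finite ℤ_[p] ℚ_[p] H (OH p H)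

/-- `|Λ / pΛ| = p ^ k` with `k ≤ dim_{ℚ_p} H * dim_H C`. -/
theorem exists_relIndex_map_nsmul [FiniteDimensional ℚ_[p] H] [FiniteDimensional H C]
    (Λ : Submodule (OH p H) C) (hΛ : Λ.FG) :
    ∃ k ≤ Module.finrank ℚ_[p] H * Module.finrank H C,
      (Λ.toAddSubgroup.map (nsmulAddMonoidHom p)).relIndex Λ.toAddSubgroup = p ^ k := by
  let : Module ℚ_[p] C := Module.compHom C (algebraMap ℚ_[p] H)
  have : IsScalarTower ℚ_[p] H C := IsScalarTower.of_algebraMap_smul fun _ _ => rfl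
  let : Algebra ℤ_[p] (OH p H) := (zpToOH p (H := H)).toAlgebra
  let : Module ℤ_[p] C := Module.compHom C (zpToOH p (H := H))
  have : IsScalarTower ℤ_[p] (OH p H) C := IsScalarTower.of_algebraMap_smul fun _ _ => rfl
  have : IsScalarTower ℤ_[p] ℚ_[p] C := IsScalarTower.of_algebraMap_smul fun _ _ => rfl
  have : FiniteDimensional ℚ_[p] C := FiniteDimensional.trans ℚ_[p] H C
  have : Module.Finite ℤ_[p] (OH p H) := zpToOH_finite
  have : Module.Finite (OH p H) Λ := Module.Finite.iff_fg.mpr hΛ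
  have : Module.Finite ℤ_[p] (Λ.restrictScalars ℤ_[p]) :=
    Module.Finite.trans (R := ℤ_[p]) (OH p H) Λ
  obtain ⟨k, hk, h⟩ :=
    exists_index_range_nsmul (Λ.restrictScalars ℤ_[p]) (Module.Finite.iff_fg.mp this)
  rw [← Module.finrank_mul_finrank ℚ_[p] H C] at hk
  refine ⟨k, hk, ?_⟩
  rw [← h]
  change _ = (nsmulAddMonoidHom p : Λ.toAddSubgroup →+ Λ.toAddSubgroup).range.index
  rw [AddSubgroup.relIndex]
  congr 1
  ext x
  rw [AddSubgroup.mem_addSubgroupOf, AddSubgroup.mem_map, AddMonoidHom.mem_range]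
  constructor
  · rintro ⟨y, hy, hxy⟩
    exact ⟨⟨y, hy⟩, Subtype.ext hxy⟩
  · rintro ⟨y, rfl⟩
    exact ⟨y, y.2, rfl⟩

theorem quotCard_eq_relIndex (N Λ : Submodule (OH p H) C) :
    quotCard N Λ = N.toAddSubgroup.relIndex Λ.toAddSubgroup :=
  rfl

theorem mem_scale {a : H} {Λ : Submodule (OH p H) C} {x : C} :
    x ∈ scale a Λ ↔ ∃ y ∈ Λ, a • y = x :=
  Iff.rfl

theorem scale_scale (a b : H) (Λ : Submodule (OH p H) C) :
    scale a (scale b Λ) = scale (a * b) Λ := by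
  ext x
  simp only [mem_scale]
  constructor
  · rintro ⟨_, ⟨z, hz, rfl⟩, rfl⟩
    exact ⟨z, hz, mul_smul a b z⟩
  · rintro ⟨z, hz, rfl⟩
    exact ⟨_, ⟨z, hz, rfl⟩, (mul_smul a b z).symm⟩

theorem scale_one (Λ : Submodule (OH p H) C) : scale 1 Λ = Λ := by
  ext x
  simp [mem_scale]

theorem scale_mono (a : H) {N Λ : Submodule (OH p H) C} (h : N ≤ Λ) : scale a N ≤ scale a Λ :=
  Submodule.map_mono h

theorem quotCard_scale {a : H} (ha : a ≠ 0) (N Λ : Submodule (OH p H) C) :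
    quotCard (scale a N) (scale a Λ) = quotCard N Λ := by
  have h (M : Submodule (OH p H) C) :
      (scale a M).toAddSubgroup = M.toAddSubgroup.map (DistribSMul.toAddMonoidHom C a) := rfl
  rw [quotCard_eq_relIndex, quotCard_eq_relIndex, h, h]
  exact AddSubgroup.relIndex_map_map_of_injective _ _ (smul_right_injective C ha)

theorem quotCard_mul_quotCard {N Λ M : Submodule (OH p H) C} (h₁ : N ≤ Λ) (h₂ : Λ ≤ M) :
    quotCard N Λ * quotCard Λ M = quotCard N M := by
  simp only [quotCard_eq_relIndex]
  exact AddSubgroup.relIndex_mul_relIndex _ _ _ h₁ h₂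

theorem quotCard_eq_one {N Λ : Submodule (OH p H) C} : quotCard N Λ = 1 ↔ Λ ≤ N := by
  rw [quotCard_eq_relIndex]
  exact AddSubgroup.relIndex_eq_one

theorem scale_zpToOH_mul_le (c : ℤ_[p]) (a : H) (Λ : Submodule (OH p H) C) :
    scale ((zpToOH p (H := H) c : H) * a) Λ ≤ scale a Λ := by
  rintro _ ⟨y, hy, rfl⟩
  refine ⟨zpToOH p (H := H) c • y, Λ.smul_mem _ hy, ?_⟩
  change a • ((zpToOH p (H := H) c : H) • y) = ((zpToOH p (H := H) c : H) * a) • y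
  rw [smul_smul, mul_comm]

variable {conj : H ≃+* H} {ϖ : H}

theorem IsRamifiedQuadratic.unif_ne_zero_s5 (hram : IsRamifiedQuadratic p H conj ϖ) : ϖ ≠ 0 := by
  rintro rfl
  have : CharZero H := charZero_of_injective_algebraMap (algebraMap ℚ_[p] H).injective
  obtain ⟨u, hu⟩ := hram.unif_sq
  have hp0 : (p : H) ≠ 0 := Nat.cast_ne_zero.mpr (Fact.out : p.Prime).ne_zero
  have hu0 : algebraMap ℚ_[p] H ((u : ℤ_[p]) : ℚ_[p]) ≠ 0 := by
    simp
  simp_all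

theorem IsRamifiedQuadratic.scale_sq (hram : IsRamifiedQuadratic p H conj ϖ)
    (Λ : Submodule (OH p H) C) : scale (ϖ * ϖ) Λ = scale (p : H) Λ := by
  obtain ⟨u, hu⟩ := hram.unif_sq
  have hu' : ϖ * ϖ = (zpToOH p (H := H) u : H) * (p : H) := hu
  have hinv : (p : H) = (zpToOH p (H := H) (u⁻¹ : ℤ_[p]ˣ) : H) * (ϖ * ϖ) := by
    rw [hu', ← mul_assoc, ← Subring.coe_mul, ← map_mul, Units.inv_mul, map_one, Subring.coe_one,
      one_mul]
  apply le_antisymm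
  · rw [hu']
    exact scale_zpToOH_mul_le _ _ _
  · nth_rw 1 [hinv]
    exact scale_zpToOH_mul_le _ _ _

/-- `0 < |Λ / ϖΛ| ≤ p ^ dim_H C`. -/
theorem IsRamifiedQuadratic.quotCard_scale_le [FiniteDimensional H C]
    (hram : IsRamifiedQuadratic p H conj ϖ) {Λ : Submodule (OH p H) C} (hΛ : Λ.FG)
    (hle : scale ϖ Λ ≤ Λ) :
    quotCard (scale ϖ Λ) Λ ≠ 0 ∧ quotCard (scale ϖ Λ) Λ ≤ p ^ Module.finrank H C := by
  have : FiniteDimensional ℚ_[p] H :=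
    FiniteDimensional.of_finrank_pos (by rw [hram.dim_two]; norm_num)
  have hp : 0 < p := (Fact.out : p.Prime).pos
  obtain ⟨k, hk, h⟩ := exists_relIndex_map_nsmul Λ hΛ
  have hpscale : (scale (p : H) Λ).toAddSubgroup =
      Λ.toAddSubgroup.map (nsmulAddMonoidHom p) := by
    ext x
    change (∃ y ∈ Λ, (p : H) • y = x) ↔ ∃ y ∈ Λ, p • y = x
    simp only [Nat.cast_smul_eq_nsmul]
  rw [← hpscale, ← quotCard_eq_relIndex, ← hram.scale_sq, ← scale_scale,
    ← quotCard_mul_quotCard (scale_mono ϖ hle) hle, quotCard_scale hram.unif_ne_zero_s5] at h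
  rw [hram.dim_two] at hk
  constructor
  · intro h0
    rw [h0, zero_mul] at h
    exact (pow_pos hp k).ne h
  · refine Nat.mul_self_le_mul_self_iff.mp ?_
    rw [h, ← pow_add, ← two_mul]
    exact Nat.pow_le_pow_right hp hk

theorem IsLattice.finiteDimensional {Λ : Submodule (OH p H) C} (hΛ : IsLattice Λ) :
    FiniteDimensional H C := by
  obtain ⟨⟨s, rfl⟩, hspan⟩ := hΛ
  refine ⟨⟨s, top_le_iff.mp ?_⟩⟩
  rw [← hspan, Submodule.span_le]
  intro x hx
  induction hx using Submodule.span_induction with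
  | mem x hx => exact Submodule.subset_span hx
  | zero => exact zero_mem _
  | add x y _ _ hx hy => exact add_mem hx hy
  | smul c x _ hx => exact Submodule.smul_mem _ (c : H) hx

theorem HermForm.le_dual_of_le_dual (φ : HermForm H C conj)
    (hconj : ∀ x ∈ OH p H, conj x ∈ OH p H) {N Λ : Submodule (OH p H) C} (h : N ≤ φ.dual Λ) :
    Λ ≤ φ.dual N := by
  intro x hx y hy
  rw [φ.form_conj y x]
  exact hconj _ (h hy x hx)

theorem IsRamifiedQuadratic.conj_mem (hram : IsRamifiedQuadratic p H conj ϖ) {x : H}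
    (hx : x ∈ OH p H) : conj x ∈ OH p H := by
  let : Algebra ℤ_[p] H := ((algebraMap ℚ_[p] H).comp PadicInt.Coe.ringHom).toAlgebra
  let f : H →ₐ[ℤ_[p]] H := { conj.toRingHom with commutes' := fun c => hram.conj_fix c }
  exact IsIntegral.map f (show IsIntegral ℤ_[p] x from hx)

end Lattice

/-- For `L` of rank `m` with form valued in `ϖ·O_H`, if `Λ ∈ Vert(L)` has
`t(Λ) = m - 2` and `dim_{𝔽_p}((ϖ⁻¹Λ♯ ∩ L♯)/Λ) = 2`, then `ϖ⁻¹Λ♯ ⊆ L♯`. -/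
theorem statement_5 (p : ℕ) [Fact (Nat.Prime p)] (hp : p ≠ 2)
    (H : Type) [Field H] [Algebra ℚ_[p] H] (conj : H ≃+* H) (ϖ : H)
    (hram : IsRamifiedQuadratic p H conj ϖ)
    (C : Type) [AddCommGroup C] [Module H C]
    (φ : HermForm H C conj)
    (hnd : ∀ x : C, (∀ y : C, φ.form x y = 0) → x = 0)
    (L Λ : Submodule (OH p H) C) (m : ℕ)
    (hL : IsLattice L)
    (hrank : Module.finrank H C = m)
    (hLπ : ∀ x ∈ L, ∀ y ∈ L, ∃ a ∈ OH p H, φ.form x y = ϖ * a)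
    (hΛ : InVert φ ϖ L Λ)
    (ht : quotCard (φ.dual Λ) Λ = p ^ (m - 2))
    (hr : quotCard Λ (scale ϖ⁻¹ (φ.dual Λ) ⊓ φ.dual L) = p ^ 2) :
    scale ϖ⁻¹ (φ.dual Λ) ≤ φ.dual L := by
  obtain ⟨⟨hlat, hsub, hdual⟩, hLdual⟩ := hΛ
  have := hL.finiteDimensional
  have hϖ := hram.unif_ne_zero_s5
  have hΛL : Λ ≤ φ.dual L := φ.le_dual_of_le_dual (fun _ => hram.conj_mem) hLdual
  have hΛD : Λ ≤ scale ϖ⁻¹ (φ.dual Λ) := by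
    have h := scale_mono ϖ⁻¹ hsub
    rwa [scale_scale, inv_mul_cancel₀ hϖ, scale_one] at h
  obtain ⟨hne, hle⟩ := hram.quotCard_scale_le hlat.1 (hsub.trans hdual)
  have hshift : quotCard (scale ϖ Λ) (φ.dual Λ) = quotCard Λ (scale ϖ⁻¹ (φ.dual Λ)) := by
    rw [← quotCard_scale (inv_ne_zero hϖ), scale_scale, inv_mul_cancel₀ hϖ, scale_one]
  rw [← quotCard_mul_quotCard hsub hdual, ht, hshift,
    ← quotCard_mul_quotCard (le_inf hΛD hΛL) inf_le_left, hr] at hne hle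
  have hpos : 0 < p := (Fact.out : p.Prime).pos
  have hm : p ^ m ≤ p ^ 2 * p ^ (m - 2) := by
    rw [← pow_add]
    exact Nat.pow_le_pow_right hpos (by omega)
  rw [hrank] at hle
  set r := quotCard (scale ϖ⁻¹ (φ.dual Λ) ⊓ φ.dual L) (scale ϖ⁻¹ (φ.dual Λ))
  have hr1 : r = 1 := by
    have hr0 : r ≠ 0 := by
      intro h0
      simp [h0] at hne
    have hq : 0 < p ^ 2 * p ^ (m - 2) := by positivity
    have hr2 : (p ^ 2 * p ^ (m - 2)) * r ≤ (p ^ 2 * p ^ (m - 2)) * 1 := by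
      calc (p ^ 2 * p ^ (m - 2)) * r = p ^ 2 * r * p ^ (m - 2) := by ring
        _ ≤ p ^ m := hle
        _ ≤ _ := by simpa using hm
    have := Nat.le_of_mul_le_mul_left hr2 hq
    omega
  exact (quotCard_eq_one.mp hr1).trans inf_le_right

end Ramified
end
end
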